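/- arXiv:1907.03681 — 3 statements merged into one kernel-verified Lean document; each statement's English description precedes it below -/
import Mathlib

section
/- Let X be a finite T₀-space and let f : X → X be a continuous map. (a) If there exist a maximal element a of X and C ∈ 𝒰(X) with C ⊆ U_a and 𝒰(f)(C) = U_a, then f has a fixed point. (b) If there exist a minimal element a of X and C ∈ ℱ(X) with C ⊆ F_a and ℱ(f)(C) = F_a, then f has a fixed point. -/
open Set

/-- The Alexandrov topology on a preorder whose open sets are exactly the lower (down) sets;
the minimal open set containing `x` is `U_x = Set.Iic x`. -/
def lowerTop (α : Type*) [Preorder α] : TopologicalSpace α where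
  IsOpen s := IsLowerSet s
  isOpen_univ := isLowerSet_univ
  isOpen_inter := fun _ _ hs ht => hs.inter ht
  isOpen_sUnion := fun _ h => isLowerSet_sUnion h

/-- A topological space has the fixed point property iff every continuous self-map has a
fixed point. -/
def HasFPP (X : Type*) [TopologicalSpace X] : Prop :=
  ∀ f : X → X, Continuous f → ∃ x, f x = x

/-- The fixed point property for a subspace of a poset endowed with the lower-set topology. -/
def SubFPP {α : Type*} [Preorder α] (C : Set α) : Prop :=
  letI := lowerTop α
  HasFPP C

/-- The fixed point property of a poset regarded as a T₀-space (lower-set topology). -/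
def PosetFPP (P : Type*) [Preorder P] : Prop :=
  letI := lowerTop P
  HasFPP P

/-- Connectedness of a poset regarded as a T₀-space (lower-set topology). -/
def PosetConnected (α : Type*) [Preorder α] : Prop :=
  letI := lowerTop α
  ConnectedSpace α

/-- A nonempty connected subspace (lower-set topology). -/
def ConnSet {α : Type*} [Preorder α] (B : Set α) : Prop :=
  letI := lowerTop α
  IsConnected B

/-- `U_A = ⋂_{a ∈ A} U_a`. -/
def UA {α : Type*} [Preorder α] (A : Set α) : Set α := ⋂ a ∈ A, Iic a

/-- `F_A = ⋂_{a ∈ A} F_a`. -/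
def FA {α : Type*} [Preorder α] (A : Set α) : Set α := ⋂ a ∈ A, Ici a

/-- The set of connected components of the subspace `S` (lower-set topology). -/
def CC {α : Type*} [Preorder α] (S : Set α) : Set (Set α) :=
  letI := lowerTop α
  {C | ∃ x ∈ S, C = connectedComponentIn S x}

/-- `𝒰(X)`: connected components of the nonempty sets `U_A`, `A` a nonempty set of maximal
elements. -/
def scrU (α : Type*) [Preorder α] : Set (Set α) :=
  {C | ∃ A : Set α, A.Nonempty ∧ (∀ a ∈ A, IsMax a) ∧ C ∈ CC (UA A)}

/-- `ℱ(X)`: connected components of the nonempty sets `F_A`, `A` a nonempty set of minimal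
elements. -/
def scrF (α : Type*) [Preorder α] : Set (Set α) :=
  {C | ∃ A : Set α, A.Nonempty ∧ (∀ a ∈ A, IsMin a) ∧ C ∈ CC (FA A)}

/-- `𝒞(X) = 𝒰(X) ∪ ℱ(X)`. -/
def scrC (α : Type*) [Preorder α] : Set (Set α) := scrU α ∪ scrF α

/-- The partial order on `𝒞(X)`. -/
def cleq (α : Type*) [Preorder α] (C₁ C₂ : Set α) : Prop :=
  (C₁ ∈ scrU α ∧ C₂ ∈ scrU α ∧ C₁ ⊆ C₂) ∨
  (C₁ ∈ scrF α ∧ C₂ ∈ scrF α ∧ C₂ ⊆ C₁) ∨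
  (C₁ ∈ scrF α ∧ C₂ ∈ scrU α ∧ (C₁ ∩ C₂).Nonempty)

/-- `UImage f C D` says that `D = 𝒰(f)(C) = min {D ∈ 𝒰(Y) ∣ f(C) ⊆ D}` (min w.r.t. `⊆`). -/
def UImage {α β : Type*} [Preorder α] [Preorder β] (f : α → β) (C : Set α) (D : Set β) : Prop :=
  D ∈ scrU β ∧ f '' C ⊆ D ∧ ∀ D' ∈ scrU β, f '' C ⊆ D' → D ⊆ D'

/-- `FImage f C D` says that `D = ℱ(f)(C) = max {D ∈ ℱ(Y) ∣ f(C) ⊆ D}` (max w.r.t. `⊆`). -/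
def FImage {α β : Type*} [Preorder α] [Preorder β] (f : α → β) (C : Set α) (D : Set β) : Prop :=
  D ∈ scrF β ∧ f '' C ⊆ D ∧ ∀ D' ∈ scrF β, f '' C ⊆ D' → D' ⊆ D

/-- `CImage f C D` says that `D = 𝒞(f)(C)`. -/
def CImage {α β : Type*} [Preorder α] [Preorder β] (f : α → β) (C : Set α) (D : Set β) : Prop :=
  (C ∈ scrU α ∧ UImage f C D) ∨ (C ∈ scrF α ∧ FImage f C D)

/-- `B♯ = {a maximal ∣ B ⊆ U_a}`. -/
def sharp {α : Type*} [Preorder α] (B : Set α) : Set α := {a | IsMax a ∧ B ⊆ Iic a}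

/-- `B♭ = {a minimal ∣ B ⊆ F_a}`. -/
def flat {α : Type*} [Preorder α] (B : Set α) : Set α := {a | IsMin a ∧ B ⊆ Ici a}

theorem Iic_mem_scrU {α : Type*} [PartialOrder α] (b : α) (hb : IsMax b) :
    Iic b ∈ scrU α := by
  refine ⟨{b}, singleton_nonempty b, by simpa using hb, ?_⟩
  letI := lowerTop α
  have hU : UA ({b} : Set α) = Iic b := by simp [UA]
  rw [hU]
  refine ⟨b, le_refl b, ?_⟩
  have hp : IsPreconnected (Iic b) := by
    rintro u v hu hv huv ⟨x, hx, hxu⟩ ⟨y, hy, hyv⟩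
    rcases huv (le_refl b : b ∈ Iic b) with h | h
    · exact ⟨y, hy, (hu : IsLowerSet u) hy h, hyv⟩
    · exact ⟨x, hx, hxu, (hv : IsLowerSet v) hx h⟩
  exact (hp.connectedComponentIn (le_refl b)).symm

theorem Ici_mem_scrF {α : Type*} [PartialOrder α] (b : α) (hb : IsMin b) :
    Ici b ∈ scrF α := by
  refine ⟨{b}, singleton_nonempty b, by simpa using hb, ?_⟩
  letI := lowerTop α
  have hU : FA ({b} : Set α) = Ici b := by simp [FA]
  rw [hU]
  refine ⟨b, le_refl b, ?_⟩
  have hp : IsPreconnected (Ici b) := by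
    rintro u v hu hv huv ⟨x, hx, hxu⟩ ⟨y, hy, hyv⟩
    exact ⟨b, le_refl b, (hu : IsLowerSet u) hx hxu, (hv : IsLowerSet v) hy hyv⟩
  exact (hp.connectedComponentIn (le_refl b)).symm

/-- if there are a maximal `a` and `C ∈ 𝒰(X)` with `C ⊆ U_a` and
`𝒰(f)(C) = U_a`, then `f` has a fixed point; dually for a minimal `a` and `C ∈ ℱ(X)` with
`C ⊆ F_a` and `ℱ(f)(C) = F_a`. -/
theorem stmt14 {α : Type*} [PartialOrder α] [Fintype α] (f : α → α) (hf : Monotone f) :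
    ((∃ a : α, IsMax a ∧ ∃ C ∈ scrU α, C ⊆ Iic a ∧ UImage f C (Iic a)) → ∃ x, f x = x) ∧
    ((∃ a : α, IsMin a ∧ ∃ C ∈ scrF α, C ⊆ Ici a ∧ FImage f C (Ici a)) → ∃ x, f x = x) := by
  constructor
  · rintro ⟨a, ha, C, -, hCa, -, -, hmin⟩
    obtain ⟨b, hab, hb⟩ := Set.Finite.exists_le_maximal (Set.toFinite (univ : Set α))
      (mem_univ (f a))
    have hb' : IsMax b := fun y hy => hb.2 (mem_univ y) hy
    have h1 : Iic a ⊆ Iic b := hmin _ (Iic_mem_scrU b hb') (by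
      rintro _ ⟨x, hx, rfl⟩
      exact (hf (hCa hx)).trans hab)
    have h2 : b ≤ a := ha (h1 (le_refl a))
    obtain ⟨m, -, hm⟩ := Set.Finite.exists_le_minimal (Set.toFinite {x : α | f x ≤ x})
      (show a ∈ {x : α | f x ≤ x} from hab.trans h2)
    have h3 : f m ≤ m := hm.1
    exact ⟨m, le_antisymm h3 (hm.2 (hf h3) h3)⟩
  · rintro ⟨a, ha, C, -, hCa, -, -, hmax⟩
    obtain ⟨b, hab, hb⟩ := Set.Finite.exists_le_minimal (Set.toFinite (univ : Set α))
      (mem_univ (f a))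
    have hb' : IsMin b := fun y hy => hb.2 (mem_univ y) hy
    have h1 : Ici b ⊆ Ici a := hmax _ (Ici_mem_scrF b hb') (by
      rintro _ ⟨x, hx, rfl⟩
      exact hab.trans (hf (hCa hx)))
    have h2 : a ≤ b := h1 (le_refl b)
    obtain ⟨m, -, hm⟩ := Set.Finite.exists_le_maximal (Set.toFinite {x : α | x ≤ f x})
      (show a ∈ {x : α | x ≤ f x} from h2.trans hab)
    have h3 : m ≤ f m := hm.1
    exact ⟨m, le_antisymm (hm.2 (hf h3) h3) h3⟩
end

section
/- Let X be a finite T₀-space, let A be a bp-retract of X with retraction r : X → A, and let i : A → X be the inclusion map. Then: (a) if every maximal element of X lies in A, then 𝒰(r)(C) = r(C) for all C ∈ 𝒰(X) and 𝒰(r)∘𝒰(i) = id on 𝒰(A); (b) if A is an ubp-retract of X, then 𝒰(r) : 𝒰(X) → 𝒰(A) is a homeomorphism (order isomorphism) with inverse 𝒰(i); (c) if every maximal element of X lies in A and A is a dbp-retract of X, then 𝒰(i)(𝒰(r)(C)) ⊆ C for every C ∈ 𝒰(X). -/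
open Set

theorem aux_cont {α β : Type*} [Preorder α] [Preorder β] {f : α → β} (hf : Monotone f) :
    @Continuous α β (lowerTop α) (lowerTop β) f := by
  letI := lowerTop α
  letI := lowerTop β
  refine continuous_def.2 fun s hs => ?_
  intro a b hba ha
  exact (show IsLowerSet s from hs) (hf hba) ha

theorem aux_pair {α : Type*} [Preorder α] {x y : α} (h : x ≤ y) :
    @IsPreconnected α (lowerTop α) {x, y} := by
  letI := lowerTop α
  intro u v hu hv _ h1 h2
  have hu' : IsLowerSet u := hu
  have hv' : IsLowerSet v := hv
  obtain ⟨a, ha, hau⟩ := h1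
  obtain ⟨b, hb, hbv⟩ := h2
  have hxa : x ≤ a := by
    rcases ha with rfl | rfl
    · exact le_rfl
    · exact h
  have hxb : x ≤ b := by
    rcases hb with rfl | rfl
    · exact le_rfl
    · exact h
  exact ⟨x, Or.inl rfl, hu' hxa hau, hv' hxb hbv⟩

theorem aux_comp {α : Type*} [Preorder α] {S C T : Set α} (hC : C ∈ CC S)
    (hT : @IsPreconnected α (lowerTop α) T) (hTS : T ⊆ S) {x : α} (hx : x ∈ C) (hxT : x ∈ T) :
    T ⊆ C := by
  letI := lowerTop α
  obtain ⟨z, hz, rfl⟩ := hC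
  rw [connectedComponentIn_eq hx]
  exact hT.subset_connectedComponentIn hxT hTS

theorem aux_sub {α : Type*} [Preorder α] {S C : Set α} (hC : C ∈ CC S) : C ⊆ S := by
  letI := lowerTop α
  obtain ⟨z, hz, rfl⟩ := hC
  exact connectedComponentIn_subset S z

theorem aux_conn {α : Type*} [Preorder α] {S C : Set α} (hC : C ∈ CC S) :
    @IsPreconnected α (lowerTop α) C := by
  letI := lowerTop α
  obtain ⟨z, hz, rfl⟩ := hC
  exact isPreconnected_connectedComponentIn

theorem aux_ne {α : Type*} [Preorder α] {S C : Set α} (hC : C ∈ CC S) : C.Nonempty := by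
  letI := lowerTop α
  obtain ⟨z, hz, rfl⟩ := hC
  exact ⟨z, mem_connectedComponentIn hz⟩

theorem aux_mk {α : Type*} [Preorder α] {S : Set α} {x : α} (hx : x ∈ S) :
    ∃ C ∈ CC S, x ∈ C := by
  letI := lowerTop α
  exact ⟨connectedComponentIn S x, ⟨x, hx, rfl⟩, mem_connectedComponentIn hx⟩

theorem aux_CC {α : Type*} [Preorder α] {S D : Set α} {x : α} (hx : x ∈ D) (hDS : D ⊆ S)
    (hD : @IsPreconnected α (lowerTop α) D)
    (hmax : ∀ T, @IsPreconnected α (lowerTop α) T → T ⊆ S → x ∈ T → T ⊆ D) : D ∈ CC S := by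
  letI := lowerTop α
  refine ⟨x, hDS hx, subset_antisymm (hD.subset_connectedComponentIn hx hDS) ?_⟩
  exact hmax _ isPreconnected_connectedComponentIn (connectedComponentIn_subset S x)
    (mem_connectedComponentIn (hDS hx))

theorem aux_le {α : Type*} [Preorder α] {S C : Set α} (hC : C ∈ CC S) {x y : α} (hx : x ∈ C)
    (hy : y ∈ S) (h : x ≤ y ∨ y ≤ x) : y ∈ C := by
  have hxS := aux_sub hC hx
  rcases h with h | h
  · refine aux_comp hC (aux_pair h) ?_ hx (Or.inl rfl) (Or.inr rfl)
    rintro z (rfl | rfl) <;> assumption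
  · refine aux_comp hC (aux_pair h) ?_ hx (Or.inr rfl) (Or.inl rfl)
    rintro z (rfl | rfl) <;> assumption

theorem aux_UA {α : Type*} [Preorder α] {M : Set α} {x : α} : x ∈ UA M ↔ ∀ m ∈ M, x ≤ m := by
  simp [UA]

theorem aux_lower {α : Type*} [Preorder α] {C : Set α} (hC : C ∈ scrU α) : IsLowerSet C := by
  obtain ⟨M, _, _, hC⟩ := hC
  intro a b hba ha
  exact aux_le hC ha (aux_UA.2 fun m hm => hba.trans (aux_UA.1 (aux_sub hC ha) m hm)) (Or.inr hba)

theorem aux_uniq {α β : Type*} [Preorder α] [Preorder β] {f : α → β} {C : Set α} {D D' : Set β}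
    (h : UImage f C D) (h' : UImage f C D') : D = D' :=
  subset_antisymm (h.2.2 _ h'.1 h'.2.1) (h'.2.2 _ h.1 h.2.1)

section
variable {α : Type*} [PartialOrder α] {A : Set α} {r : α → ↥A}

/-- Images of components are components. -/
theorem aux_img (hmono : Monotone r) (hretr : ∀ a : ↥A, r ↑a = a)
    (hcmp : ∀ x, (r x : α) ≤ x ∨ x ≤ (r x : α))
    {M : Set α} (hMA : M ⊆ A) {C : Set α} (hC : C ∈ CC (UA M)) :
    (∀ x ∈ C, (r x : α) ∈ C) ∧ r '' C ∈ CC (UA (Subtype.val ⁻¹' M : Set A)) := by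
  have hrU : ∀ x ∈ UA M, (r x : α) ∈ UA M := by
    intro x hx
    refine aux_UA.2 fun m hm => ?_
    have := hmono (aux_UA.1 hx m hm)
    rw [hretr ⟨m, hMA hm⟩] at this
    exact this
  have h1 : ∀ x ∈ C, (r x : α) ∈ C := fun x hx =>
    aux_le hC hx (hrU x (aux_sub hC hx)) (hcmp x).symm
  refine ⟨h1, ?_⟩
  obtain ⟨x, hx⟩ := aux_ne hC
  refine aux_CC (mem_image_of_mem r hx) ?_ ?_ ?_
  · rintro _ ⟨y, hy, rfl⟩
    exact aux_UA.2 fun m hm => aux_UA.1 (aux_sub hC (h1 y hy)) m hm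
  · letI := lowerTop α
    letI := lowerTop A
    exact (aux_conn hC).image r (aux_cont hmono).continuousOn
  · intro T hT hTS hxT
    have h2 : Subtype.val '' T ⊆ C := by
      refine aux_comp hC ?_ ?_ (h1 x hx) (mem_image_of_mem _ hxT)
      · letI := lowerTop α
        letI := lowerTop A
        exact hT.image _ (aux_cont (Subtype.mono_coe _)).continuousOn
      · rintro _ ⟨y, hy, rfl⟩
        exact aux_UA.2 fun m hm => aux_UA.1 (hTS hy) ⟨m, hMA hm⟩ hm
    intro t ht
    exact ⟨t, h2 (mem_image_of_mem _ ht), hretr t⟩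

theorem aux_a1 (hmono : Monotone r) (hretr : ∀ a : ↥A, r ↑a = a)
    (hcmp : ∀ x, (r x : α) ≤ x ∨ x ≤ (r x : α)) (hmax : ∀ a : α, IsMax a → a ∈ A)
    {C : Set α} (hC : C ∈ scrU α) : (∀ x ∈ C, (r x : α) ∈ C) ∧ UImage r C (r '' C) := by
  obtain ⟨M, ⟨m, hm⟩, hM, hC⟩ := hC
  have hMA : M ⊆ A := fun m hm => hmax m (hM m hm)
  obtain ⟨h1, h2⟩ := aux_img hmono hretr hcmp hMA hC
  refine ⟨h1, ⟨Subtype.val ⁻¹' M, ⟨⟨m, hMA hm⟩, hm⟩, ?_, h2⟩, subset_rfl, fun _ _ h => h⟩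
  intro a ha b hab
  exact hM a ha hab

theorem aux_a2 [Fintype α] (hmono : Monotone r) (hretr : ∀ a : ↥A, r ↑a = a)
    (hcmp : ∀ x, (r x : α) ≤ x ∨ x ≤ (r x : α)) (hmax : ∀ a : α, IsMax a → a ∈ A)
    {D : Set A} (hD : D ∈ scrU A) {E : Set α} (hE : UImage (Subtype.val : A → α) D E) :
    UImage r E D := by
  have hrE := (aux_a1 hmono hretr hcmp hmax hE.1).2
  suffices h : r '' E = D by rwa [h] at hrE
  refine subset_antisymm ?_ fun d hd => ⟨d, hE.2.1 (mem_image_of_mem _ hd), hretr d⟩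
  obtain ⟨N, ⟨n, hn⟩, hN, hDC⟩ := hD
  have hNmax : ∀ a ∈ N, IsMax (a : α) := by
    intro a ha
    obtain ⟨m, ham, hm⟩ := Finite.exists_le_maximal (p := fun _ : α => True) (a := (a : α)) trivial
    have hm' : IsMax m := fun b hb => hm.2 trivial hb
    have h3 : m ≤ a := hN a ha (b := ⟨m, hmax m hm'⟩) ham
    rwa [← le_antisymm h3 ham]
  obtain ⟨d, hd⟩ := aux_ne hDC
  have hDU : ∀ y ∈ D, (y : α) ∈ UA (Subtype.val '' N : Set α) := by
    intro y hy
    refine aux_UA.2 ?_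
    rintro _ ⟨k, hk, rfl⟩
    exact aux_UA.1 (aux_sub hDC hy) k hk
  obtain ⟨C, hC, hdC⟩ := aux_mk (hDU d hd)
  have hCU : C ∈ scrU α := by
    refine ⟨_, ⟨n, mem_image_of_mem _ hn⟩, ?_, hC⟩
    rintro _ ⟨k, hk, rfl⟩
    exact hNmax k hk
  have hDsub : Subtype.val '' D ⊆ C := by
    refine aux_comp hC ?_ ?_ hdC (mem_image_of_mem _ hd)
    · letI := lowerTop α
      letI := lowerTop A
      exact (aux_conn hDC).image _ (aux_cont (Subtype.mono_coe _)).continuousOn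
    · rintro _ ⟨y, hy, rfl⟩
      exact hDU y hy
  have hEC := hE.2.2 C hCU hDsub
  have hMA : (Subtype.val '' N : Set α) ⊆ A := by
    rintro _ ⟨k, hk, rfl⟩
    exact k.2
  have h4 := (aux_img hmono hretr hcmp hMA hC).2
  rw [preimage_image_eq _ Subtype.val_injective] at h4
  refine (image_mono hEC).trans ?_
  exact aux_comp hDC (aux_conn h4) (aux_sub h4) hd ⟨d, hdC, hretr d⟩

end

/-- for a bp-retract `A` of `X` with retraction `r : X → A` and inclusion
`i : A → X`: (a) if all maximal elements of `X` lie in `A` then `𝒰(r)(C) = r(C)` for all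
`C ∈ 𝒰(X)` and `𝒰(r)∘𝒰(i) = id`; (b) if `A` is an ubp-retract then `𝒰(r)` is a
homeomorphism (order isomorphism) with inverse `𝒰(i)`; (c) if all maximal elements of `X` lie
in `A` and `A` is a dbp-retract then `𝒰(i)(𝒰(r)(C)) ⊆ C` for all `C ∈ 𝒰(X)`. -/
theorem stmt16 {α : Type*} [PartialOrder α] [Fintype α] (A : Set α) (r : α → ↥A)
    (hmono : Monotone r) (hretr : ∀ a : ↥A, r ↑a = a) :
    ((((∀ x, (r x : α) ≤ x) ∨ (∀ x, x ≤ (r x : α))) → (∀ a : α, IsMax a → a ∈ A) →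
      (∀ C ∈ scrU α, UImage r C (r '' C)) ∧
      (∀ D ∈ scrU (↥A), ∀ E, UImage (Subtype.val : ↥A → α) D E → UImage r E D))) ∧
    ((∀ x, x ≤ (r x : α)) →
      (∀ C ∈ scrU α, ∀ D, UImage r C D → UImage (Subtype.val : ↥A → α) D C) ∧
      (∀ D ∈ scrU (↥A), ∀ C, UImage (Subtype.val : ↥A → α) D C → UImage r C D) ∧
      (∀ C₁ ∈ scrU α, ∀ C₂ ∈ scrU α, ∀ D₁ D₂, UImage r C₁ D₁ → UImage r C₂ D₂ →
        (C₁ ⊆ C₂ ↔ D₁ ⊆ D₂))) ∧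
    ((∀ x, (r x : α) ≤ x) → (∀ a : α, IsMax a → a ∈ A) →
      ∀ C ∈ scrU α, ∀ D E, UImage r C D → UImage (Subtype.val : ↥A → α) D E → E ⊆ C) := by
  refine ⟨?_, ?_, ?_⟩
  · intro h hmax
    have hcmp : ∀ x, (r x : α) ≤ x ∨ x ≤ (r x : α) := fun x => h.imp (fun h => h x) (fun h => h x)
    exact ⟨fun C hC => (aux_a1 hmono hretr hcmp hmax hC).2,
      fun D hD E hE => aux_a2 hmono hretr hcmp hmax hD hE⟩
  · intro h
    have hcmp : ∀ x, (r x : α) ≤ x ∨ x ≤ (r x : α) := fun x => Or.inr (h x)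
    have hmax : ∀ a : α, IsMax a → a ∈ A := by
      intro a ha
      rw [le_antisymm (h a) (ha (h a))]
      exact (r a).2
    refine ⟨?_, fun D hD E hE => aux_a2 hmono hretr hcmp hmax hD hE, ?_⟩
    · intro C hC D hD
      obtain ⟨h1, h2⟩ := aux_a1 hmono hretr hcmp hmax hC
      obtain rfl := aux_uniq hD h2
      refine ⟨hC, ?_, ?_⟩
      · rintro _ ⟨_, ⟨x, hx, rfl⟩, rfl⟩
        exact h1 x hx
      · intro C' hC' hs x hx
        exact aux_lower hC' (h x) (hs ⟨r x, ⟨x, hx, rfl⟩, rfl⟩)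
    · intro C₁ hC₁ C₂ hC₂ D₁ D₂ hD₁ hD₂
      obtain ⟨h1, h2⟩ := aux_a1 hmono hretr hcmp hmax hC₁
      obtain ⟨h3, h4⟩ := aux_a1 hmono hretr hcmp hmax hC₂
      obtain rfl := aux_uniq hD₁ h2
      obtain rfl := aux_uniq hD₂ h4
      refine ⟨fun hs => image_mono hs, fun hs x hx => ?_⟩
      obtain ⟨y, hy, hyx⟩ := hs ⟨x, hx, rfl⟩
      have h5 := h3 y hy
      rw [hyx] at h5
      exact aux_lower hC₂ (h x) h5
  · intro h hmax C hC D E hD hE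
    have hcmp : ∀ x, (r x : α) ≤ x ∨ x ≤ (r x : α) := fun x => Or.inl (h x)
    obtain ⟨h1, h2⟩ := aux_a1 hmono hretr hcmp hmax hC
    obtain rfl := aux_uniq hD h2
    refine hE.2.2 C hC ?_
    rintro _ ⟨_, ⟨x, hx, rfl⟩, rfl⟩
    exact h1 x hx
end

section
/- Let X be a finite T₀-space such that every C ∈ 𝒰(X) has a maximum element, and let X' = {max C : C ∈ 𝒰(X)} ⊆ X. Then X' is an ubp-retract of X, and the maps φ : 𝒰(X) → X' given by φ(C) = max C and ψ : X' → 𝒰(X) given by ψ(z) = U_z are mutually inverse order isomorphisms (where 𝒰(X) is ordered by inclusion and X' carries the order induced from X). -/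
open Set

theorem aux_preconn {α : Type*} [Preorder α] (m : α) :
    @IsPreconnected α (lowerTop α) (Iic m) := by
  letI := lowerTop α
  intro u v hu hv hsub hnu hnv
  have hu' : IsLowerSet u := hu
  have hv' : IsLowerSet v := hv
  obtain ⟨a, ha, hau⟩ := hnu
  obtain ⟨b, hb, hbv⟩ := hnv
  rcases hsub (show m ∈ Iic m from le_refl m) with hm | hm
  · exact ⟨b, hb, hu' hb hm, hbv⟩
  · exact ⟨a, ha, hau, hv' ha hm⟩

theorem aux_UA_lower {α : Type*} [Preorder α] (A : Set α) : IsLowerSet (UA A) := by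
  intro a b hba ha
  simp only [UA, mem_iInter, mem_Iic] at ha ⊢
  exact fun i hi => hba.trans (ha i hi)

theorem aux_Iic_sub {α : Type*} [Preorder α] {S : Set α} (hS : IsLowerSet S) {m : α}
    (hm : m ∈ S) : Iic m ⊆ @connectedComponentIn α (lowerTop α) S m := by
  letI := lowerTop α
  exact (aux_preconn m).subset_connectedComponentIn (show m ∈ Iic m from le_refl m)
    (fun y hy => hS hy hm)

theorem aux_eq {α : Type*} [Preorder α] {C : Set α} (hC : C ∈ scrU α) {m : α}
    (hm : IsGreatest C m) : C = Iic m := by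
  letI := lowerTop α
  obtain ⟨A, -, -, x, hx, rfl⟩ := hC
  apply subset_antisymm
  · exact fun y hy => hm.2 hy
  · rw [connectedComponentIn_eq hm.1]
    exact aux_Iic_sub (aux_UA_lower A) (connectedComponentIn_subset _ _ hm.1)

theorem aux_UA_anti {α : Type*} [Preorder α] {A B : Set α} (h : A ⊆ B) : UA B ⊆ UA A :=
  biInter_subset_biInter_left h

theorem aux_mem {α : Type*} [Preorder α] (x : α) : x ∈ UA (sharp {x}) := by
  simp only [UA, mem_iInter, mem_Iic]
  exact fun i hi => hi.2 rfl

theorem aux_scr {α : Type*} [PartialOrder α] [Fintype α] (x : α) :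
    @connectedComponentIn α (lowerTop α) (UA (sharp {x})) x ∈ scrU α := by
  refine ⟨sharp {x}, ?_, fun a ha => ha.1, x, aux_mem x, rfl⟩
  obtain ⟨b, hxb, hb⟩ := Finite.exists_le_maximal (p := fun _ : α => True) (a := x) trivial
  exact ⟨b, fun c hc => hb.2 trivial hc, by simpa using hxb⟩

/-- if every `C ∈ 𝒰(X)` has a maximum and `X' = {max C ∣ C ∈ 𝒰(X)}`, then
`X'` is an ubp-retract of `X` (there is a monotone retraction `r` onto `X'` with `id ≤ r`),
and `C ↦ max C`, `z ↦ U_z` are mutually inverse order isomorphisms between `(𝒰(X), ⊆)` and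
`X'`. -/
theorem stmt18 {α : Type*} [PartialOrder α] [Fintype α]
    (h : ∀ C ∈ scrU α, ∃ m, IsGreatest C m) :
    (∃ r : α → α, Monotone r ∧ (∀ x, r x ∈ {x : α | ∃ C ∈ scrU α, IsGreatest C x}) ∧
      (∀ a ∈ {x : α | ∃ C ∈ scrU α, IsGreatest C x}, r a = a) ∧ (∀ x, x ≤ r x)) ∧
    (∀ C ∈ scrU α, ∀ m, IsGreatest C m → C = Iic m) ∧
    (∀ z ∈ {x : α | ∃ C ∈ scrU α, IsGreatest C x}, Iic z ∈ scrU α ∧ IsGreatest (Iic z) z) ∧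
    (∀ C₁ ∈ scrU α, ∀ C₂ ∈ scrU α, ∀ m₁ m₂, IsGreatest C₁ m₁ → IsGreatest C₂ m₂ →
      (C₁ ⊆ C₂ ↔ m₁ ≤ m₂)) := by
  letI := lowerTop α
  refine ⟨?_, fun C hC m hm => aux_eq hC hm, ?_, ?_⟩
  · choose r hr using fun x : α => h _ (aux_scr x)
    refine ⟨r, ?_, fun x => ⟨_, aux_scr x, hr x⟩, ?_, fun x =>
      (hr x).2 (mem_connectedComponentIn (aux_mem x))⟩
    · intro x y hxy
      apply (hr y).2
      have hx : x ∈ connectedComponentIn (UA (sharp {y})) y :=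
        aux_Iic_sub (aux_UA_lower _) (aux_mem y) hxy
      rw [connectedComponentIn_eq hx]
      refine connectedComponentIn_mono x (aux_UA_anti ?_) (hr x).1
      intro a ha
      have := ha.2 rfl
      exact ⟨ha.1, by simpa using hxy.trans this⟩
    · rintro a ⟨C, ⟨A, -, hA, x, hx, rfl⟩, ha⟩
      apply le_antisymm
      · apply ha.2
        rw [connectedComponentIn_eq ha.1]
        refine connectedComponentIn_mono a (aux_UA_anti ?_) (hr a).1
        intro b hb
        have h1 := connectedComponentIn_subset _ _ ha.1
        simp only [UA, mem_iInter, mem_Iic] at h1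
        exact ⟨hA b hb, by simpa using h1 b hb⟩
      · exact (hr a).2 (mem_connectedComponentIn (aux_mem a))
  · rintro z ⟨C, hC, hz⟩
    exact ⟨aux_eq hC hz ▸ hC, isGreatest_Iic⟩
  · intro C₁ h₁ C₂ h₂ m₁ m₂ g₁ g₂
    rw [aux_eq h₁ g₁, aux_eq h₂ g₂, Iic_subset_Iic]
end
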